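/- arXiv:1303.1115 — 3 statements merged into one kernel-verified Lean document; each statement's English description precedes it below -/
import Mathlib

section
/- Let X and Y be compact Hausdorff spaces. The assignment h ↦ (x ↦ ev_x ∘ h), where ev_x : C(X,ℂ) → ℂ is evaluation at x, is a bijection between the set of positive unital ℂ-linear maps C(Y,ℂ) → C(X,ℂ) and the set of continuous maps from X to the state space of C(Y,ℂ) equipped with the weak-* topology. -/
/-- A continuous complex-valued function is positive when all its values are
nonnegative reals. -/
def PosFn {X : Type*} [TopologicalSpace X] (v : C(X, ℂ)) : Prop :=
  ∀ x : X, ∃ r : ℝ, 0 ≤ r ∧ v x = r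

/-- The states of `C(Y, ℂ)` inside its weak-* dual. -/
def cstateSet (Y : Type*) [TopologicalSpace Y] [CompactSpace Y] [T2Space Y] :
    Set (WeakDual ℂ C(Y, ℂ)) :=
  {φ | φ 1 = 1 ∧ ∀ v : C(Y, ℂ), PosFn v → ∃ r : ℝ, 0 ≤ r ∧ φ v = r}

open scoped ComplexOrder

theorem posFn_iff_nonneg {X : Type*} [TopologicalSpace X] (v : C(X, ℂ)) : PosFn v ↔ 0 ≤ v := by
  rw [ContinuousMap.le_def]
  refine forall_congr' fun x => ⟨?_, fun hx => ?_⟩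
  · rintro ⟨r, hr, hv⟩
    rw [hv]
    exact Complex.zero_le_real.mpr hr
  · exact ⟨(v x).re, (Complex.nonneg_iff.mp hx).1, Complex.eq_re_of_ofReal_le hx⟩

/-- A positive linear functional on `C(Y, ℂ)` is automatically continuous. -/
theorem continuous_of_posFn {Y : Type*} [TopologicalSpace Y] [CompactSpace Y]
    (φ : C(Y, ℂ) →ₗ[ℂ] ℂ) (hφ : ∀ v : C(Y, ℂ), PosFn v → ∃ r : ℝ, 0 ≤ r ∧ φ v = r) :
    Continuous φ :=
  map_continuous (PositiveLinearMap.mk₀ φ fun v hv => by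
    obtain ⟨r, hr, hv⟩ := hφ v ((posFn_iff_nonneg v).mpr hv)
    rw [hv]
    exact Complex.zero_le_real.mpr hr)

/-- for compact Hausdorff `X`, `Y`, the assignment
`h ↦ (x ↦ ev_x ∘ h)` is a bijection between the positive unital `ℂ`-linear maps
`C(Y,ℂ) → C(X,ℂ)` and the continuous maps from `X` to the state space of
`C(Y,ℂ)` with the weak-* topology. -/
theorem positive_unital_maps_equiv_continuous_maps_to_states
    (X Y : Type*) [TopologicalSpace X] [CompactSpace X] [T2Space X]
    [TopologicalSpace Y] [CompactSpace Y] [T2Space Y] :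
    ∃ e : {h : C(Y, ℂ) →ₗ[ℂ] C(X, ℂ) //
            h 1 = 1 ∧ ∀ v : C(Y, ℂ), PosFn v → PosFn (h v)} ≃
          C(X, cstateSet Y),
      ∀ (h : {h : C(Y, ℂ) →ₗ[ℂ] C(X, ℂ) //
            h 1 = 1 ∧ ∀ v : C(Y, ℂ), PosFn v → PosFn (h v)}) (x : X) (v : C(Y, ℂ)),
        ((e h x : WeakDual ℂ C(Y, ℂ))) v = (h.1 v) x := by
  let toDual (h : {h : C(Y, ℂ) →ₗ[ℂ] C(X, ℂ) //
      h 1 = 1 ∧ ∀ v : C(Y, ℂ), PosFn v → PosFn (h v)}) (x : X) : WeakDual ℂ C(Y, ℂ) :=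
    StrongDual.toWeakDual
      ⟨(ContinuousMap.evalCLM ℂ x : C(X, ℂ) →L[ℂ] ℂ).toLinearMap ∘ₗ h.1,
        continuous_of_posFn _ fun v hv => h.2.2 v hv x⟩
  have toDual_apply : ∀ h x v, toDual h x v = h.1 v x := fun _ _ _ => rfl
  refine ⟨{
    toFun := fun h => ⟨fun x => ⟨toDual h x, ?_, fun v hv => ?_⟩, ?_⟩
    invFun := fun f => ⟨{
        toFun := fun v => ⟨fun x => (f x : WeakDual ℂ C(Y, ℂ)) v,
          (WeakDual.eval_continuous v).comp (continuous_subtype_val.comp f.continuous)⟩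
        map_add' := fun v w => ContinuousMap.ext fun x => map_add (f x).1 v w
        map_smul' := fun c v => ContinuousMap.ext fun x => map_smul (f x).1 c v },
      ContinuousMap.ext fun x => (f x).2.1, fun v hv x => (f x).2.2 v hv⟩
    left_inv := fun h => rfl
    right_inv := fun f => rfl }, fun h x v => rfl⟩
  · rw [toDual_apply, h.2.1, ContinuousMap.one_apply]
  · exact h.2.2 v hv x
  · exact (WeakDual.continuous_of_continuous_eval fun v => (h.1 v).continuous).subtype_mk _
end

section
/- Let X be a compact Hausdorff space. The extreme points of the convex set of states of C(X,ℂ) are exactly the Dirac (evaluation) states: a state φ is an extreme point if and only if there exists x ∈ X with φ(f) = f(x) for all f ∈ C(X,ℂ). -/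
/-- A state of `C(X,ℂ)`: a unital linear functional sending positive functions
to nonnegative reals. -/
def IsCState {X : Type*} [TopologicalSpace X] (φ : C(X, ℂ) →ₗ[ℂ] ℂ) : Prop :=
  φ 1 = 1 ∧ ∀ f : C(X, ℂ), PosFn f → ∃ r : ℝ, 0 ≤ r ∧ φ f = r

/-- A real-valued continuous function, regarded as a complex-valued one. -/
def complexify {X : Type*} [TopologicalSpace X] (g : C(X, ℝ)) : C(X, ℂ) :=
  ⟨fun x => (g x : ℂ), by fun_prop⟩

@[simp]
lemma complexify_apply {X : Type*} [TopologicalSpace X] (g : C(X, ℝ)) (x : X) :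
    complexify g x = (g x : ℂ) := rfl

lemma posFn_complexify {X : Type*} [TopologicalSpace X] {g : C(X, ℝ)} (hg : ∀ x, 0 ≤ g x) :
    PosFn (complexify g) :=
  fun x => ⟨g x, hg x, rfl⟩

lemma exists_eq_complexify_add {X : Type*} [TopologicalSpace X] (f : C(X, ℂ)) :
    ∃ u v : C(X, ℝ), f = complexify u + Complex.I • complexify v := by
  refine ⟨⟨fun x => (f x).re, by fun_prop⟩, ⟨fun x => (f x).im, by fun_prop⟩, ?_⟩
  ext x
  simp [mul_comm Complex.I, Complex.re_add_im]

/-- Linear functionals on `C(X, ℂ)` agreeing on real-valued functions are equal. -/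
lemma linearMap_ext_complexify {X : Type*} [TopologicalSpace X] {φ ψ : C(X, ℂ) →ₗ[ℂ] ℂ}
    (h : ∀ g, φ (complexify g) = ψ (complexify g)) : φ = ψ := by
  ext f
  obtain ⟨u, v, rfl⟩ := exists_eq_complexify_add f
  simp [h]

lemma PosFn.mul {X : Type*} [TopologicalSpace X] {f g : C(X, ℂ)} (hf : PosFn f) (hg : PosFn g) :
    PosFn (f * g) := by
  intro x
  obtain ⟨r, hr, hfr⟩ := hf x
  obtain ⟨s, hs, hgs⟩ := hg x
  exact ⟨r * s, mul_nonneg hr hs, by simp [hfr, hgs]⟩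

/-- The functional `f ↦ φ (h * f) / t` is a state when `h` is positive and `φ h = t > 0`. -/
lemma IsCState.smul_comp_mulLeft {X : Type*} [TopologicalSpace X] {φ : C(X, ℂ) →ₗ[ℂ] ℂ}
    (hφ : IsCState φ) {h : C(X, ℂ)} (hh : PosFn h) {t : ℝ} (ht : 0 < t) (hφh : φ h = t) :
    IsCState ((t : ℂ)⁻¹ • φ ∘ₗ LinearMap.mulLeft ℂ h) := by
  have ht' : (t : ℂ) ≠ 0 := by exact_mod_cast ht.ne'
  refine ⟨by simp [hφh, ht'], fun f hf => ?_⟩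
  obtain ⟨r, hr, hfr⟩ := hφ.2 _ (hh.mul hf)
  exact ⟨t⁻¹ * r, by positivity, by simp [hfr]⟩

/-- A state vanishing on the nonnegative functions that vanish at `x` is evaluation at `x` on
real-valued functions. -/
lemma IsCState.apply_complexify_eq {X : Type*} [TopologicalSpace X] {φ : C(X, ℂ) →ₗ[ℂ] ℂ}
    (hφ : IsCState φ) {x : X}
    (hx : ∀ g : C(X, ℝ), (∀ y, 0 ≤ g y) → g x = 0 → φ (complexify g) = 0) (g : C(X, ℝ)) :
    φ (complexify g) = g x := by
  set k : C(X, ℝ) := g - ContinuousMap.const X (g x) with hk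
  have hgk : complexify g = complexify k + (g x : ℂ) • 1 := by
    ext y; simp [hk]
  have hpos : φ (complexify (k ⊔ 0)) = 0 := hx _ (fun y => by simp) (by simp [hk])
  have hneg : φ (complexify (-k ⊔ 0)) = 0 := hx _ (fun y => by simp) (by simp [hk])
  have hsub : complexify k = complexify (k ⊔ 0) - complexify (-k ⊔ 0) := by
    ext y
    simp only [complexify_apply, ContinuousMap.sub_apply, ContinuousMap.sup_apply,
      ContinuousMap.neg_apply, ContinuousMap.zero_apply]
    rw [← Complex.ofReal_sub]
    congr 1
    rcases le_total 0 (k y) with h | h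
    · rw [sup_eq_left.2 h, sup_eq_right.2 (by linarith)]; ring
    · rw [sup_eq_right.2 h, sup_eq_left.2 (by linarith)]; ring
  rw [hgk, map_add, hsub, map_sub, hpos, hneg, map_smul, hφ.1]
  simp

/-- A state occurring with positive weight in a decomposition of an evaluation is that
evaluation. -/
lemma IsCState.eq_of_add_eq_eval {X : Type*} [TopologicalSpace X] {φ φ₁ φ₂ : C(X, ℂ) →ₗ[ℂ] ℂ}
    (h₁ : IsCState φ₁) (h₂ : IsCState φ₂) {a₁ a₂ : ℝ} (ha₁ : 0 < a₁) (ha₂ : 0 < a₂)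
    (hφ : φ = (a₁ : ℂ) • φ₁ + (a₂ : ℂ) • φ₂) {x : X} (hx : ∀ f, φ f = f x) : φ₁ = φ := by
  refine linearMap_ext_complexify fun g => ?_
  rw [hx, h₁.apply_complexify_eq (x := x), complexify_apply]
  intro k hk hkx
  obtain ⟨r, hr, hkr⟩ := h₁.2 _ (posFn_complexify hk)
  obtain ⟨s, hs, hks⟩ := h₂.2 _ (posFn_complexify hk)
  have h := hx (complexify k)
  simp only [hφ, LinearMap.add_apply, LinearMap.smul_apply, hkr, hks, complexify_apply, hkx,
    smul_eq_mul] at h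
  norm_cast at h
  have hr0 : r = 0 := by
    have := mul_nonneg ha₂.le hs
    have : a₁ * r = 0 := le_antisymm (by linarith) (by positivity)
    exact (mul_eq_zero.1 this).resolve_left ha₁.ne'
  simp [hkr, hr0]

/-- The property of a state of being an extreme point of the set of states. -/
def IsExtremeCState {X : Type*} [TopologicalSpace X] (φ : C(X, ℂ) →ₗ[ℂ] ℂ) : Prop :=
  ∀ φ₁ φ₂ : C(X, ℂ) →ₗ[ℂ] ℂ, IsCState φ₁ → IsCState φ₂ →
    ∀ a₁ a₂ : ℝ, 0 < a₁ → a₁ < 1 → 0 < a₂ → a₂ < 1 → a₁ + a₂ = 1 →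
      φ = (a₁ : ℂ) • φ₁ + (a₂ : ℂ) • φ₂ → φ₁ = φ ∨ φ₂ = φ

/-- An extreme state is multiplicative against a function with values in `[1/4, 3/4]`. -/
lemma IsExtremeCState.map_mul_of_mem_Icc {X : Type*} [TopologicalSpace X]
    {φ : C(X, ℂ) →ₗ[ℂ] ℂ} (hext : IsExtremeCState φ) (hφ : IsCState φ) {h : C(X, ℝ)}
    (hh : ∀ x, h x ∈ Set.Icc (1 / 4 : ℝ) (3 / 4)) (f : C(X, ℂ)) :
    φ (complexify h * f) = φ (complexify h) * φ f := by
  have hlow : PosFn (complexify h - (1 / 4 : ℂ) • 1) := fun x =>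
    ⟨h x - 1 / 4, by linarith [(hh x).1], by simp⟩
  have hhigh : PosFn ((3 / 4 : ℂ) • 1 - complexify h) := fun x =>
    ⟨3 / 4 - h x, by linarith [(hh x).2], by simp⟩
  have hpos : PosFn (complexify h) := posFn_complexify fun x => by linarith [(hh x).1]
  have hpos' : PosFn (1 - complexify h) := fun x =>
    ⟨1 - h x, by linarith [(hh x).2], by simp⟩
  obtain ⟨t, -, ht⟩ := hφ.2 _ hpos
  obtain ⟨r, hr, hr'⟩ := hφ.2 _ hlow
  obtain ⟨s, hs, hs'⟩ := hφ.2 _ hhigh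
  rw [map_sub, map_smul, hφ.1, ht] at hr' hs'
  have hr₁ := congrArg Complex.re hr'
  have hs₁ := congrArg Complex.re hs'
  norm_num at hr₁ hs₁
  have ht0 : 0 < t := by linarith
  have ht1 : 0 < 1 - t := by linarith
  have ht0' : (t : ℂ) ≠ 0 := by exact_mod_cast ht0.ne'
  have ht1' : ((1 - t : ℝ) : ℂ) ≠ 0 := by exact_mod_cast ht1.ne'
  have hcompl : φ (1 - complexify h) = ((1 - t : ℝ) : ℂ) := by simp [hφ.1, ht]
  rcases hext _ _ (hφ.smul_comp_mulLeft hpos ht0 ht) (hφ.smul_comp_mulLeft hpos' ht1 hcompl)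
    t (1 - t) ht0 (by linarith) ht1 (by linarith) (by ring)
    (by
      rw [smul_smul, smul_smul, mul_inv_cancel₀ ht0', mul_inv_cancel₀ ht1']
      refine LinearMap.ext fun f => ?_
      simp [sub_mul]) with heq | heq
  · have := LinearMap.congr_fun heq f
    rw [LinearMap.smul_apply, smul_eq_mul, inv_mul_eq_iff_eq_mul₀ ht0'] at this
    rw [ht, ← this]
    rfl
  · have := LinearMap.congr_fun heq f
    rw [LinearMap.smul_apply, smul_eq_mul, inv_mul_eq_iff_eq_mul₀ ht1'] at this
    simp only [LinearMap.comp_apply, LinearMap.mulLeft_apply, sub_mul, one_mul, map_sub,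
      Complex.ofReal_sub, Complex.ofReal_one] at this
    rw [ht]
    linear_combination -this

/-- Extreme states are multiplicative. -/
lemma IsExtremeCState.map_mul {X : Type*} [TopologicalSpace X] [CompactSpace X]
    {φ : C(X, ℂ) →ₗ[ℂ] ℂ} (hext : IsExtremeCState φ) (hφ : IsCState φ) (f g : C(X, ℂ)) :
    φ (f * g) = φ f * φ g := by
  have hreal (u : C(X, ℝ)) : φ (complexify u * g) = φ (complexify u) * φ g := by
    set M : ℝ := ‖u‖ + 1
    have hM : 0 < M := by positivity
    have hM' : (M : ℂ) ≠ 0 := by exact_mod_cast hM.ne'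
    set h : C(X, ℝ) := ContinuousMap.const X (1 / 2) + (4 * M)⁻¹ • u with hh
    have hmem (x : X) : h x ∈ Set.Icc (1 / 4 : ℝ) (3 / 4) := by
      have hx : |u x| ≤ M := (u.norm_coe_le_norm x).trans (by simp [M])
      have hx' : |(4 * M)⁻¹ * u x| ≤ 1 / 4 := by
        rw [abs_mul, abs_of_pos (by positivity), inv_mul_le_iff₀ (by positivity)]
        linarith
      rw [abs_le] at hx'
      simp only [hh, ContinuousMap.add_apply, ContinuousMap.const_apply, ContinuousMap.smul_apply,
        smul_eq_mul]
      constructor <;> linarith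
    have hu : complexify u = (4 * M : ℂ) • complexify h - (2 * M : ℂ) • 1 := by
      ext x
      simp [hh]
      field_simp
      ring
    rw [hu, sub_mul, smul_mul_assoc, smul_mul_assoc, one_mul, map_sub, map_sub, map_smul, map_smul,
      map_smul, map_smul, hφ.1, hext.map_mul_of_mem_Icc hφ hmem]
    simp only [smul_eq_mul]
    ring
  obtain ⟨u, v, rfl⟩ := exists_eq_complexify_add f
  rw [add_mul, smul_mul_assoc, map_add, map_add, map_smul, map_smul, hreal, hreal]
  simp only [smul_eq_mul]
  ring

/-- An algebra homomorphism `C(X, ℂ) → ℂ` is evaluation at a point. -/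
lemma exists_algHom_eq_eval {X : Type*} [TopologicalSpace X] [CompactSpace X] [T2Space X]
    (ψ : C(X, ℂ) →ₐ[ℂ] ℂ) : ∃ x : X, ∀ f : C(X, ℂ), ψ f = f x := by
  obtain ⟨x, hx⟩ := (WeakDual.CharacterSpace.continuousMapEval_bijective (X := X) (𝕜 := ℂ)).2
    (WeakDual.CharacterSpace.equivAlgHom.symm ψ)
  refine ⟨x, fun f => ?_⟩
  simpa using (DFunLike.congr_fun hx f).symm

/-- for a compact Hausdorff space `X`, the extreme points of the
convex set of states of `C(X,ℂ)` are exactly the Dirac (evaluation) states. -/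
theorem extreme_state_iff_dirac
    {X : Type*} [TopologicalSpace X] [CompactSpace X] [T2Space X]
    (φ : C(X, ℂ) →ₗ[ℂ] ℂ) (hφ : IsCState φ) :
    (∀ φ₁ φ₂ : C(X, ℂ) →ₗ[ℂ] ℂ, IsCState φ₁ → IsCState φ₂ →
        ∀ a₁ a₂ : ℝ, 0 < a₁ → a₁ < 1 → 0 < a₂ → a₂ < 1 → a₁ + a₂ = 1 →
          φ = (a₁ : ℂ) • φ₁ + (a₂ : ℂ) • φ₂ → φ₁ = φ ∨ φ₂ = φ) ↔
      ∃ x : X, ∀ f : C(X, ℂ), φ f = f x := by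
  constructor
  · intro hext
    exact exists_algHom_eq_eval
      (AlgHom.ofLinearMap φ hφ.1 (IsExtremeCState.map_mul hext hφ))
  · rintro ⟨x, hx⟩ φ₁ φ₂ h₁ h₂ a₁ a₂ ha₁ - ha₂ - - h
    exact Or.inl (h₁.eq_of_add_eq_eval h₂ ha₁ ha₂ h hx)
end

section
/- Let A and B be unital C*-algebras with state spaces S(A), S(B) equipped with the weak-* topology. The assignment f ↦ (φ ↦ φ ∘ f) is a bijection between the set of positive unital ℂ-linear maps A → B and the set of continuous affine maps S(B) → S(A). In particular: (faithfulness) if f, g : A → B are positive unital maps with φ ∘ f = φ ∘ g for all states φ of B, then f = g; and (fullness) every continuous affine map g : S(B) → S(A) is of the form φ ↦ φ ∘ f for some positive unital map f : A → B. -/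
/-- An element of a C*-algebra is positive if it is of the form `y* y`. -/
def IsPosElem {A : Type*} [CStarAlgebra A] (x : A) : Prop :=
  ∃ y : A, x = star y * y

/-- The set of states of a unital C*-algebra, inside the weak-* dual. -/
def stateSet (A : Type*) [CStarAlgebra A] : Set (WeakDual ℂ A) :=
  {φ | φ 1 = 1 ∧ ∀ x : A, IsPosElem x → ∃ r : ℝ, 0 ≤ r ∧ φ x = r}

/-- A map between state spaces is affine if it preserves convex combinations. -/
def AffineStateMap {A B : Type*} [CStarAlgebra A] [CStarAlgebra B]
    (g : stateSet B → stateSet A) : Prop :=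
  ∀ (φ ψ : stateSet B) (t : ℝ), 0 ≤ t → t ≤ 1 →
    ∀ h : t • (φ : WeakDual ℂ B) + (1 - t) • (ψ : WeakDual ℂ B) ∈ stateSet B,
      (g ⟨_, h⟩ : WeakDual ℂ A)
        = t • (g φ : WeakDual ℂ A) + (1 - t) • (g ψ : WeakDual ℂ A)

/-- A continuous affine function on a compact convex set is uniformly close to the real part of a
continuous linear functional plus a constant. -/
theorem exists_strongDual_forall_abs_sub_lt {E : Type*} [AddCommGroup E] [TopologicalSpace E]
    [Module ℂ E] [Module ℝ E] [IsScalarTower ℝ ℂ E] [IsTopologicalAddGroup E]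
    [ContinuousSMul ℂ E] [T2Space E] (hE : LocallyConvexSpace ℝ E) {K : Set E} (hK : IsCompact K)
    (hconv : Convex ℝ K) {h : K → ℝ} (hc : Continuous h)
    (ha : ∀ (x y : K) (s t : ℝ) (hs : 0 ≤ s) (ht : 0 ≤ t) (hst : s + t = 1),
      h ⟨s • x.1 + t • y.1, hconv x.2 y.2 hs ht hst⟩ = s * h x + t * h y)
    {ε : ℝ} (hε : 0 < ε) :
    ∃ (l : StrongDual ℂ E) (c : ℝ), ∀ x : K, |h x - ((l x).re + c)| < ε := by
  have : CompactSpace K := isCompact_iff_compactSpace.1 hK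
  let graph (δ : ℝ) : Set (E × ℂ) := Set.range fun x : K => (x.1, ((h x + δ : ℝ) : ℂ))
  have hcompact (δ : ℝ) : IsCompact (graph δ) := isCompact_range (by fun_prop)
  have hconvex (δ : ℝ) : Convex ℝ (graph δ) := by
    rintro _ ⟨x, rfl⟩ _ ⟨y, rfl⟩ s t hs ht hst
    refine ⟨⟨_, hconv x.2 y.2 hs ht hst⟩, Prod.ext rfl ?_⟩
    simp only [Prod.smul_mk, Prod.mk_add_mk, Complex.real_smul]
    rw [ha x y s t hs ht hst, ← Complex.ofReal_mul, ← Complex.ofReal_mul, ← Complex.ofReal_add]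
    congr 1
    linear_combination -δ * hst
  have hdisj : Disjoint (graph 0) (graph ε) := by
    rw [Set.disjoint_left]
    rintro _ ⟨x, rfl⟩ ⟨y, hy⟩
    obtain ⟨h1, h2⟩ := Prod.ext_iff.1 hy
    obtain rfl : y = x := Subtype.ext h1
    have : h y + ε = h y + 0 := Complex.ofReal_injective h2
    linarith
  obtain ⟨L, u, v, hL, huv, hL'⟩ := RCLike.geometric_hahn_banach_compact_closed (𝕜 := ℂ)
    (hconvex 0) (hcompact 0) (hconvex ε) (hcompact ε).isClosed hdisj
  set k : ℝ := (L (0, 1)).re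
  have hsplit (x : K) (r : ℝ) : (L (x.1, (r : ℂ))).re = (L (x.1, 0)).re + r * k := by
    have : ((x.1, (r : ℂ)) : E × ℂ) = (x.1, 0) + (r : ℂ) • (0, 1) := by simp
    rw [this, map_add, map_smul]
    simp [k]
  have hlow (x : K) : (L (x.1, 0)).re + h x * k < u := by
    have := hL _ ⟨x, rfl⟩
    simpa only [RCLike.re_to_complex, hsplit, add_zero] using this
  have hhigh (x : K) : v < (L (x.1, 0)).re + (h x + ε) * k := by
    have := hL' _ ⟨x, rfl⟩
    simpa only [RCLike.re_to_complex, hsplit] using this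
  refine ⟨(-k⁻¹ : ℂ) • L.comp (ContinuousLinearMap.inl ℂ E ℂ), u / k, fun x => ?_⟩
  have h1 := hlow x
  have h2 := hhigh x
  have hk : 0 < k := by
    by_contra! hk
    nlinarith
  have heq : ((((-k⁻¹ : ℂ) • L.comp (ContinuousLinearMap.inl ℂ E ℂ)) x.1).re + u / k) =
      (u - (L (x.1, 0)).re) / k := by
    rw [← Complex.ofReal_neg]
    simp only [smul_apply, ContinuousLinearMap.comp_apply, ContinuousLinearMap.inl_apply,
      smul_eq_mul, Complex.re_ofReal_mul]
    ring
  rw [heq, abs_lt]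
  constructor
  · rw [neg_lt_sub_iff_lt_add, div_lt_iff₀ hk]
    linarith
  · rw [sub_lt_iff_lt_add, ← sub_lt_iff_lt_add', lt_div_iff₀ hk]
    nlinarith

open scoped ComplexStarModule

theorem state_apply_algebraMap {A : Type*} [CStarAlgebra A] {φ : WeakDual ℂ A}
    (hφ : φ ∈ stateSet A) (r : ℝ) :
    φ (algebraMap ℝ A r) = r := by
  rw [IsScalarTower.algebraMap_apply ℝ ℂ A, Algebra.algebraMap_eq_smul_one, map_smul, hφ.1]
  simp

section

variable {A : Type*} [CStarAlgebra A] [PartialOrder A] [StarOrderedRing A]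

theorem isPosElem_iff_nonneg {x : A} : IsPosElem x ↔ 0 ≤ x :=
  CStarAlgebra.nonneg_iff_eq_star_mul_self.symm

theorem mem_stateSet_iff {φ : WeakDual ℂ A} :
    φ ∈ stateSet A ↔ φ 1 = 1 ∧ ∀ x : A, 0 ≤ x → 0 ≤ (φ x).re ∧ (φ x).im = 0 := by
  simp only [stateSet, Set.mem_ofPred_eq, isPosElem_iff_nonneg]
  refine and_congr_right fun _ => forall₂_congr fun x _ => ⟨?_, fun h => ⟨(φ x).re, h.1, ?_⟩⟩
  · rintro ⟨r, hr, h⟩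
    simpa [h] using hr
  · apply Complex.ext <;> simp [h.2]

theorem state_im_eq_zero {φ : WeakDual ℂ A} (hφ : φ ∈ stateSet A) {x : A}
    (hx : IsSelfAdjoint x) : (φ x).im = 0 := by
  have h := ((mem_stateSet_iff.1 hφ).2 _ (sub_nonneg.2 hx.le_algebraMap_norm_self)).2
  simpa [map_sub, state_apply_algebraMap hφ] using h

theorem state_abs_re_le_norm {φ : WeakDual ℂ A} (hφ : φ ∈ stateSet A) {x : A}
    (hx : IsSelfAdjoint x) : |(φ x).re| ≤ ‖x‖ := by
  have h := ((mem_stateSet_iff.1 hφ).2 _ (sub_nonneg.2 hx.le_algebraMap_norm_self)).1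
  have h' := ((mem_stateSet_iff.1 hφ).2 _ (sub_nonneg.2 hx.neg.le_algebraMap_norm_self)).1
  simp [map_sub, state_apply_algebraMap hφ] at h h'
  exact abs_le.2 ⟨by linarith, by linarith⟩

theorem state_apply_eq {φ : WeakDual ℂ A} (hφ : φ ∈ stateSet A) (x : A) :
    φ x = (φ (ℜ x : A)).re + Complex.I * (φ (ℑ x : A)).re := by
  conv_lhs => rw [← realPart_add_I_smul_imaginaryPart x, map_add, map_smul]
  have h1 := state_im_eq_zero hφ (ℜ x).2
  have h2 := state_im_eq_zero hφ (ℑ x).2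
  apply Complex.ext <;> simp [h1, h2]

theorem isClosed_stateSet : IsClosed (stateSet A) := by
  have : stateSet A = {φ | φ 1 = 1} ∩ ⋂ x : A, ⋂ _ : 0 ≤ x,
      ({φ | 0 ≤ (φ x).re} ∩ {φ | (φ x).im = 0}) := by
    ext φ
    simp [mem_stateSet_iff]
  rw [this]
  have hc := fun x : A => WeakDual.eval_continuous (𝕜 := ℂ) x
  refine (isClosed_eq (hc 1) continuous_const).inter (isClosed_iInter fun x =>
    isClosed_iInter fun _ => ?_)
  exact (isClosed_le continuous_const (Complex.continuous_re.comp (hc x))).inter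
    (isClosed_eq (Complex.continuous_im.comp (hc x)) continuous_const)

theorem norm_state_apply_le {φ : WeakDual ℂ A} (hφ : φ ∈ stateSet A) (x : A) :
    ‖φ x‖ ≤ 2 * ‖x‖ := by
  have h1 := (state_abs_re_le_norm hφ (ℜ x).2).trans (realPart.norm_le x)
  have h2 := (state_abs_re_le_norm hφ (ℑ x).2).trans (imaginaryPart.norm_le x)
  rw [state_apply_eq hφ x]
  refine (norm_add_le _ _).trans ?_
  simp only [norm_mul, Complex.norm_I, one_mul, Complex.norm_real, Real.norm_eq_abs]
  linarith

theorem isCompact_stateSet : IsCompact (stateSet A) := by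
  refine (WeakDual.isCompact_closedBall (𝕜 := ℂ) (0 : StrongDual ℂ A) 2).of_isClosed_subset
    isClosed_stateSet fun φ hφ => ?_
  simp only [Set.mem_preimage, mem_closedBall_zero_iff]
  exact ContinuousLinearMap.opNorm_le_bound _ zero_le_two (norm_state_apply_le hφ)

theorem convex_stateSet : Convex ℝ (stateSet A) := by
  intro φ hφ ψ hψ s t hs ht hst
  have hadd (x : A) : (s • φ + t • ψ) x = s * φ x + t * ψ x := rfl
  rw [mem_stateSet_iff] at *
  refine ⟨?_, fun x hx => ?_⟩
  · rw [hadd, hφ.1, hψ.1]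
    exact_mod_cast by simpa using hst
  · have h1 := hφ.2 x hx
    have h2 := hψ.2 x hx
    rw [hadd]
    simp [h1.2, h2.2]
    have := h1.1
    have := h2.1
    positivity

/-- States detect positivity of self-adjoint elements. -/
theorem nonneg_of_forall_state {b : A} (hb : IsSelfAdjoint b)
    (h : ∀ φ ∈ stateSet A, 0 ≤ (φ b).re) : 0 ≤ b := by
  by_contra hneg
  have hconv : Convex ℝ {a : A | 0 ≤ a} := fun x hx y hy s t hs ht _ =>
    add_nonneg (smul_nonneg hs hx) (smul_nonneg ht hy)
  obtain ⟨f, u, hfb, hf⟩ := RCLike.geometric_hahn_banach_point_closed (𝕜 := ℂ) hconv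
    CStarAlgebra.isClosed_nonneg hneg
  have hu : u < 0 := by simpa using hf 0 (by simp)
  have hpos (x : A) (hx : 0 ≤ x) : 0 ≤ (f x).re := by
    by_contra! hlt
    have := hf ((u / (f x).re) • x) (smul_nonneg (div_nonneg_of_nonpos hu.le hlt.le) hx)
    rw [← Complex.coe_smul, map_smul] at this
    simp [hlt.ne] at this
  have hbpos : 0 < (f 1).re := by
    have h' := hpos _ (sub_nonneg.2 hb.neg.le_algebraMap_norm_self)
    rw [IsScalarTower.algebraMap_apply ℝ ℂ A, Algebra.algebraMap_eq_smul_one, map_sub, map_smul,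
      map_neg] at h'
    simp at h' hfb
    by_contra! h1
    nlinarith [norm_nonneg b]
  let g : A →L[ℂ] ℂ := ((starL ℂ : ℂ ≃L⋆[ℂ] ℂ) : ℂ →L⋆[ℂ] ℂ).comp
    (f.comp ((starL ℂ : A ≃L⋆[ℂ] A) : A →L⋆[ℂ] A))
  let ψ : WeakDual ℂ A := StrongDual.toWeakDual ((2 * (f 1).re : ℂ)⁻¹ • (f + g))
  have hψ (x : A) (hx : IsSelfAdjoint x) : ψ x = ((f x).re / (f 1).re : ℝ) := by
    have hg : g x = star (f (star x)) := rfl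
    have : ψ x = (2 * (f 1).re : ℂ)⁻¹ * (f x + g x) := rfl
    have h2 : ((f 1).re : ℂ) ≠ 0 := by exact_mod_cast hbpos.ne'
    rw [this, hg, hx.star_eq, Complex.star_def, Complex.add_conj]
    push_cast
    field_simp
  have hmem : ψ ∈ stateSet A := by
    refine mem_stateSet_iff.2 ⟨?_, fun x hx => ?_⟩
    · rw [hψ 1 (.one A), div_self hbpos.ne', Complex.ofReal_one]
    · rw [hψ x (.of_nonneg hx)]
      exact ⟨div_nonneg (hpos x hx) hbpos.le, rfl⟩
  have := h ψ hmem
  rw [hψ b hb, Complex.ofReal_re] at this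
  exact absurd this (not_le.2 (div_neg_of_neg_of_pos (hfb.trans hu) hbpos))

theorem norm_le_of_forall_state {b : A} (hb : IsSelfAdjoint b) {C : ℝ} (hC : 0 ≤ C)
    (h : ∀ φ ∈ stateSet A, |(φ b).re| ≤ C) : ‖b‖ ≤ C := by
  have hsa (r : ℝ) : IsSelfAdjoint (algebraMap ℝ A r) := .algebraMap A (.all r)
  have hle : b ≤ algebraMap ℝ A C := by
    refine sub_nonneg.1 (nonneg_of_forall_state ((hsa C).sub hb) fun φ hφ => ?_)
    simpa [map_sub, state_apply_algebraMap hφ] using (abs_le.1 (h φ hφ)).2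
  have hge : algebraMap ℝ A (-C) ≤ b := by
    refine sub_nonneg.1 (nonneg_of_forall_state (hb.sub (hsa _)) fun φ hφ => ?_)
    rw [map_sub, state_apply_algebraMap hφ]
    simpa using neg_le_iff_add_nonneg.1 (abs_le.1 (h φ hφ)).1
  rw [le_algebraMap_iff_spectrum_le] at hle
  rw [algebraMap_le_iff_le_spectrum] at hge
  cases subsingleton_or_nontrivial A
  · simpa [Subsingleton.elim b 0] using hC
  rcases CStarAlgebra.norm_or_neg_norm_mem_spectrum hb with hx | hx
  · exact hle _ hx
  · exact neg_le_neg_iff.1 (hge _ hx)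

theorem eq_zero_of_forall_state {b : A} (h : ∀ φ ∈ stateSet A, φ b = 0) : b = 0 := by
  have h0 (φ) (hφ : φ ∈ stateSet A) : (φ (ℜ b : A)).re = 0 ∧ (φ (ℑ b : A)).re = 0 := by
    have := h φ hφ
    rw [state_apply_eq hφ, Complex.ext_iff] at this
    simpa using this
  have h1 : (ℜ b : A) = 0 := norm_le_zero_iff.1 <|
    norm_le_of_forall_state (ℜ b).2 le_rfl fun φ hφ => by simp [(h0 φ hφ).1]
  have h2 : (ℑ b : A) = 0 := norm_le_zero_iff.1 <|
    norm_le_of_forall_state (ℑ b).2 le_rfl fun φ hφ => by simp [(h0 φ hφ).2]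
  rw [← realPart_add_I_smul_imaginaryPart b, h1, h2]
  simp

theorem eq_of_forall_state {a b : A} (h : ∀ φ ∈ stateSet A, φ a = φ b) : a = b :=
  sub_eq_zero.1 <| eq_zero_of_forall_state fun φ hφ => by rw [map_sub, h φ hφ, sub_self]

theorem nonneg_of_forall_state_nonneg {b : A}
    (h : ∀ φ ∈ stateSet A, 0 ≤ (φ b).re ∧ (φ b).im = 0) : 0 ≤ b := by
  have hb : (ℜ b : A) = b := eq_of_forall_state fun φ hφ => by
    have := (h φ hφ).2
    rw [state_apply_eq hφ b] at this ⊢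
    have him := state_im_eq_zero hφ (ℜ b).2
    apply Complex.ext <;> simp_all
  exact nonneg_of_forall_state (hb ▸ (ℜ b).2) fun φ hφ => (h φ hφ).1

/-- Evaluation of self-adjoint elements on the state space. -/
noncomputable def stateEval (b : selfAdjoint A) : C(stateSet A, ℝ) where
  toFun φ := (φ.1 (b : A)).re
  continuous_toFun := Complex.continuous_re.comp
    ((WeakDual.eval_continuous (𝕜 := ℂ) (b : A)).comp continuous_subtype_val)

theorem isometry_stateEval [CompactSpace (stateSet A)] :
    Isometry (stateEval : selfAdjoint A → C(stateSet A, ℝ)) := by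
  refine Isometry.of_dist_eq fun a b => le_antisymm ?_ ?_
  · refine (ContinuousMap.dist_le dist_nonneg).2 fun φ => ?_
    simpa [stateEval, Real.dist_eq, dist_eq_norm, map_sub] using
      state_abs_re_le_norm φ.2 (a - b).2
  · rw [dist_eq_norm]
    refine norm_le_of_forall_state (a - b).2 dist_nonneg fun φ hφ => ?_
    simpa [stateEval, Real.dist_eq, map_sub] using
      (stateEval a).dist_apply_le_dist (g := stateEval b) ⟨φ, hφ⟩

/-- A continuous affine function on the state space is uniformly close to an evaluation. -/
theorem exists_selfAdjoint_forall_abs_sub_lt {h : stateSet A → ℝ} (hc : Continuous h)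
    (ha : ∀ (φ ψ : stateSet A) (s t : ℝ) (hs : 0 ≤ s) (ht : 0 ≤ t) (hst : s + t = 1),
      h ⟨s • φ.1 + t • ψ.1, convex_stateSet φ.2 ψ.2 hs ht hst⟩ = s * h φ + t * h ψ)
    {ε : ℝ} (hε : 0 < ε) :
    ∃ b : selfAdjoint A, ∀ φ, |h φ - stateEval b φ| < ε := by
  have : IsScalarTower ℝ ℂ (WeakDual ℂ A) :=
    ⟨fun r c φ => DFunLike.ext _ _ fun x => smul_assoc r c (φ x)⟩
  obtain ⟨l, c, hl⟩ :=
    exists_strongDual_forall_abs_sub_lt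
      (WeakBilin.locallyConvexSpace (B := topDualPairing ℂ A))
      isCompact_stateSet convex_stateSet hc ha hε
  obtain ⟨a, rfl⟩ := LinearMap.dualEmbedding_surjective (topDualPairing ℂ A) l
  refine ⟨ℜ a + ⟨algebraMap ℝ A c, .algebraMap A (.all c)⟩, fun φ => ?_⟩
  convert hl φ using 3
  change (φ.1 ((ℜ a : A) + algebraMap ℝ A c)).re = (φ.1 a).re + c
  rw [map_add, state_apply_algebraMap φ.2, state_apply_eq φ.2 a]
  simp

/-- Kadison's function representation of the self-adjoint part of a C*-algebra. -/
theorem exists_selfAdjoint_stateEval_eq {h : stateSet A → ℝ} (hc : Continuous h)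
    (ha : ∀ (φ ψ : stateSet A) (s t : ℝ) (hs : 0 ≤ s) (ht : 0 ≤ t) (hst : s + t = 1),
      h ⟨s • φ.1 + t • ψ.1, convex_stateSet φ.2 ψ.2 hs ht hst⟩ = s * h φ + t * h ψ) :
    ∃ b : selfAdjoint A, ∀ φ, stateEval b φ = h φ := by
  have : CompactSpace (stateSet A) := isCompact_iff_compactSpace.1 isCompact_stateSet
  have : CompleteSpace (selfAdjoint A) :=
    (isClosed_eq continuous_star continuous_id).completeSpace_coe
  have hclosed := (isometry_stateEval (A := A)).isClosedEmbedding.isClosed_range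
  have hmem : (⟨h, hc⟩ : C(stateSet A, ℝ)) ∈ closure (Set.range (stateEval (A := A))) := by
    refine Metric.mem_closure_range_iff.2 fun ε hε => ?_
    obtain ⟨b, hb⟩ := exists_selfAdjoint_forall_abs_sub_lt hc ha hε
    exact ⟨b, (ContinuousMap.dist_lt_iff hε).2 hb⟩
  rw [hclosed.closure_eq] at hmem
  obtain ⟨b, hb⟩ := hmem
  exact ⟨b, fun φ => DFunLike.congr_fun hb φ⟩

/-- Pulling back a self-adjoint element along a continuous affine map of state spaces. -/
theorem AffineStateMap.exists_selfAdjoint {C : Type*} [CStarAlgebra C]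
    {g : stateSet A → stateSet C} (hg : AffineStateMap g) (hc : Continuous g) (x : selfAdjoint C) :
    ∃ b : selfAdjoint A, ∀ φ, stateEval b φ = stateEval x (g φ) := by
  refine exists_selfAdjoint_stateEval_eq ((stateEval x).continuous.comp hc)
    fun φ ψ s t hs ht hst => ?_
  obtain rfl : t = 1 - s := by linarith
  have h := hg φ ψ s hs (by linarith) (convex_stateSet φ.2 ψ.2 hs ht hst)
  change ((g _).1 (x : C)).re = s * ((g φ).1 (x : C)).re + (1 - s) * ((g ψ).1 (x : C)).re
  rw [h]
  change (s • (g φ).1 (x : C) + (1 - s) • (g ψ).1 (x : C)).re = _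
  simp only [Complex.add_re, Complex.smul_re, smul_eq_mul]

variable {B : Type*} [CStarAlgebra B] [PartialOrder B] [StarOrderedRing B]

theorem AffineStateMap.exists_apply_eq {g : stateSet B → stateSet A} (hg : AffineStateMap g)
    (hc : Continuous g) (a : A) : ∃ b : B, ∀ φ, (g φ).1 a = φ.1 b := by
  obtain ⟨b, hb⟩ := hg.exists_selfAdjoint hc (ℜ a)
  obtain ⟨c, hc⟩ := hg.exists_selfAdjoint hc (ℑ a)
  refine ⟨b + Complex.I • (c : B), fun φ => ?_⟩
  have hb' : (φ.1 (b : B)).re = ((g φ).1 (ℜ a : A)).re := hb φ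
  have hc' : (φ.1 (c : B)).re = ((g φ).1 (ℑ a : A)).re := hc φ
  rw [state_apply_eq (g φ).2, ← hb', ← hc', map_add, map_smul]
  have h1 := state_im_eq_zero φ.2 b.2
  have h2 := state_im_eq_zero φ.2 c.2
  apply Complex.ext <;> simp [h1, h2]

/-- Every continuous affine map of state spaces is induced by a positive unital map. -/
theorem AffineStateMap.exists_linearMap {g : stateSet B → stateSet A} (hg : AffineStateMap g)
    (hc : Continuous g) :
    ∃ f : A →ₗ[ℂ] B, f 1 = 1 ∧ (∀ x : A, IsPosElem x → IsPosElem (f x)) ∧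
      ∀ (φ : stateSet B) (a : A), (g φ).1 a = φ.1 (f a) := by
  choose f hf using hg.exists_apply_eq hc
  refine ⟨{ toFun := f, map_add' := fun x y => ?_, map_smul' := fun c x => ?_ }, ?_, ?_,
    fun φ a => hf a φ⟩
  · refine eq_of_forall_state fun φ hφ => ?_
    rw [map_add, ← hf _ ⟨φ, hφ⟩, ← hf _ ⟨φ, hφ⟩, ← hf _ ⟨φ, hφ⟩, map_add]
  · refine eq_of_forall_state fun φ hφ => ?_
    rw [RingHom.id_apply, map_smul, ← hf _ ⟨φ, hφ⟩, ← hf _ ⟨φ, hφ⟩, map_smul]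
  · refine eq_of_forall_state fun φ hφ => ?_
    exact (hf 1 ⟨φ, hφ⟩).symm.trans ((g ⟨φ, hφ⟩).2.1.trans hφ.1.symm)
  · intro x hx
    rw [isPosElem_iff_nonneg] at hx ⊢
    refine nonneg_of_forall_state_nonneg fun φ hφ => ?_
    change 0 ≤ (φ (f x)).re ∧ (φ (f x)).im = 0
    rw [← hf x ⟨φ, hφ⟩]
    exact (mem_stateSet_iff.1 (g ⟨φ, hφ⟩).2).2 x hx

theorem continuous_of_map_isPosElem {f : A →ₗ[ℂ] B}
    (hf : ∀ x : A, IsPosElem x → IsPosElem (f x)) : Continuous f :=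
  map_continuous (PositiveLinearMap.mk₀ f fun x hx =>
    isPosElem_iff_nonneg.1 (hf x (isPosElem_iff_nonneg.2 hx)))
end

/-- the assignment `f ↦ (φ ↦ φ ∘ f)` is a bijection between the
positive unital `ℂ`-linear maps `A → B` and the continuous affine maps
`S(B) → S(A)`; in particular it is faithful and full. -/
theorem positive_unital_maps_equiv_continuous_affine_state_maps
    (A B : Type*) [CStarAlgebra A] [CStarAlgebra B] :
    (∃ e : {f : A →ₗ[ℂ] B // f 1 = 1 ∧ ∀ x : A, IsPosElem x → IsPosElem (f x)} ≃
            {g : stateSet B → stateSet A // Continuous g ∧ AffineStateMap g},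
      ∀ (f : {f : A →ₗ[ℂ] B // f 1 = 1 ∧ ∀ x : A, IsPosElem x → IsPosElem (f x)})
        (φ : stateSet B) (a : A),
          ((e f).1 φ : WeakDual ℂ A) a = (φ : WeakDual ℂ B) (f.1 a)) ∧
    (∀ f g : A →ₗ[ℂ] B,
      f 1 = 1 → (∀ x : A, IsPosElem x → IsPosElem (f x)) →
      g 1 = 1 → (∀ x : A, IsPosElem x → IsPosElem (g x)) →
      (∀ φ ∈ stateSet B, ∀ a : A, φ (f a) = φ (g a)) → f = g) ∧
    (∀ g : stateSet B → stateSet A, Continuous g → AffineStateMap g →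
      ∃ f : A →ₗ[ℂ] B, f 1 = 1 ∧ (∀ x : A, IsPosElem x → IsPosElem (f x)) ∧
        ∀ (φ : stateSet B) (a : A),
          (g φ : WeakDual ℂ A) a = (φ : WeakDual ℂ B) (f a)) := by
  let := CStarAlgebra.spectralOrder A
  let := CStarAlgebra.spectralOrder B
  have := CStarAlgebra.spectralOrderedRing A
  have := CStarAlgebra.spectralOrderedRing B
  have faithful (f g : A →ₗ[ℂ] B) (h : ∀ φ ∈ stateSet B, ∀ a : A, φ (f a) = φ (g a)) : f = g :=
    LinearMap.ext fun a => eq_of_forall_state fun φ hφ => h φ hφ a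
  refine ⟨?_, fun f g _ _ _ _ h => faithful f g h, fun g hc hg => hg.exists_linearMap hc⟩
  let pull (f : {f : A →ₗ[ℂ] B // f 1 = 1 ∧ ∀ x : A, IsPosElem x → IsPosElem (f x)}) :
      {g : stateSet B → stateSet A // Continuous g ∧ AffineStateMap g} :=
    ⟨fun φ => ⟨StrongDual.toWeakDual ((WeakDual.toStrongDual φ.1).comp
        ⟨f.1, continuous_of_map_isPosElem f.2.2⟩),
      (congrArg φ.1 f.2.1).trans φ.2.1, fun x hx => φ.2.2 _ (f.2.2 x hx)⟩,
      Continuous.subtype_mk (WeakDual.continuous_of_continuous_eval fun a =>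
        (WeakDual.eval_continuous (𝕜 := ℂ) (f.1 a)).comp continuous_subtype_val) _,
      fun _ _ _ _ _ _ => rfl⟩
  have hpull (f) (φ : stateSet B) (a : A) : ((pull f).1 φ).1 a = φ.1 (f.1 a) := rfl
  refine ⟨Equiv.ofBijective pull ⟨fun f g h => Subtype.ext (faithful _ _ fun φ hφ a => ?_),
    fun g => ?_⟩, hpull⟩
  · rw [← hpull f ⟨φ, hφ⟩, h, hpull g ⟨φ, hφ⟩]
  · obtain ⟨f, h1, hpos, hf⟩ := g.2.2.exists_linearMap g.2.1
    exact ⟨⟨f, h1, hpos⟩, Subtype.ext <| funext fun φ => Subtype.ext <|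
      DFunLike.ext _ _ fun a => (hf φ a).symm⟩
end
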